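/- The Hamiltonian vector fields X₁, X₂, X₃ of the n=3 Stäckel system of Example 1 pairwise commute: [Xᵣ, Xₛ] = 0 for r,s ∈ {1,2,3}, where [·,·] is the Lie bracket (commutator) of vector fields on ℝ⁶. -/

import Mathlib

/-- Lie bracket of vector fields on ℝ⁶: [X,Y](ξ) = DY(ξ)·X(ξ) − DX(ξ)·Y(ξ). -/
noncomputable def lieBracket (X Y : (Fin 6 → ℝ) → (Fin 6 → ℝ)) (ξ : Fin 6 → ℝ) : Fin 6 → ℝ :=
  fderiv ℝ Y ξ (X ξ) - fderiv ℝ X ξ (Y ξ)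

/-- The Lie bracket vanishes at `ξ` if, for every `i`, the derivative of the `i`-th component of `Y`
along `X` equals the derivative of the `i`-th component of `X` along `Y`. -/
theorem lieBracket_eq_zero_of_components {X Y : (Fin 6 → ℝ) → (Fin 6 → ℝ)} {ξ : Fin 6 → ℝ}
    (hX : ∀ i, DifferentiableAt ℝ (fun x => X x i) ξ)
    (hY : ∀ i, DifferentiableAt ℝ (fun x => Y x i) ξ)
    (h : ∀ i, fderiv ℝ (fun x => Y x i) ξ (X ξ) = fderiv ℝ (fun x => X x i) ξ (Y ξ)) :
    lieBracket X Y ξ = 0 := by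
  have eX : fderiv ℝ X ξ = ContinuousLinearMap.pi fun i => fderiv ℝ (fun x => X x i) ξ :=
    fderiv_pi hX
  have eY : fderiv ℝ Y ξ = ContinuousLinearMap.pi fun i => fderiv ℝ (fun x => Y x i) ξ :=
    fderiv_pi hY
  ext i
  simp [lieBracket, eX, eY, h i]

theorem fderiv_coordinate (ξ : Fin 6 → ℝ) (i : Fin 6) :
    fderiv ℝ (fun x : Fin 6 → ℝ => x i) ξ = ContinuousLinearMap.proj i :=
  (ContinuousLinearMap.proj (R := ℝ) (φ := fun _ : Fin 6 => ℝ) i).fderiv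

set_option maxHeartbeats 1000000 in
theorem stmt9 (c : ℝ)
    (X1 X2 X3 : (Fin 6 → ℝ) → (Fin 6 → ℝ))
    (hX1 : X1 = fun ξ =>
      let q1 := ξ 0; let q2 := ξ 1; let q3 := ξ 2
      let p1 := ξ 3; let p2 := ξ 4; let p3 := ξ 5
      ![2*p3,
        2*q1*p3 + 2*p2,
        2*q1*p2 + 2*q2*p3 + 2*p1,
        -2*p2*p3 - 5*q1^4 + 12*q1^2*q2 - 6*q1*q3 - 3*q2^2 - c,
        -p3^2 + 4*q1^3 - 6*q1*q2 + 2*q3,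
        -3*q1^2 + 2*q2])
    (hX2 : X2 = fun ξ =>
      let q1 := ξ 0; let q2 := ξ 1; let q3 := ξ 2
      let p1 := ξ 3; let p2 := ξ 4; let p3 := ξ 5
      ![2*p2 + 2*q1*p3,
        2*p1 + 2*q1^2*p3 + 4*q1*p2,
        2*q1*p1 + 2*(q1*q2 - q3)*p3 + 2*q1^2*p2,
        -2*p1*p3 - 2*p2^2 - 4*q1*p2*p3 - q2*p3^2 + 6*q1*q2^2 - 4*q1^3*q2 + 3*q1^2*q3 - 4*q2*q3,
        -q1*p3^2 - q1^4 + 6*q1^2*q2 - 4*q1*q3 - 3*q2^2 - c,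
        p3^2 + q1^3 - 4*q1*q2 + 2*q3])
    (hX3 : X3 = fun ξ =>
      let q1 := ξ 0; let q2 := ξ 1; let q3 := ξ 2
      let p1 := ξ 3; let p2 := ξ 4; let p3 := ξ 5
      ![2*q1*p2 + 2*q2*p3 + 2*p1,
        2*q1^2*p2 + 2*q1*p1 + 2*(q1*q2 - q3)*p3,
        2*q2*p1 + 2*(q2^2 - q1*q3)*p3 + 2*(q1*q2 - q3)*p2,
        -2*q1*p2^2 - 2*q2*p2*p3 + q3*p3^2 - 4*q1^3*q3 + 6*q1*q2*q3 - 2*p1*p2 - 2*q3^2,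
        -2*p1*p3 - 2*q1*p2*p3 - 2*q2*p3^2 + 3*q1^2*q3 - 2*q2*q3,
        q1*p3^2 + 3*q1^2*q2 + 2*p2*p3 - q1^4 - 4*q1*q3 - q2^2 - c]) :
    (∀ ξ, lieBracket X1 X2 ξ = 0) ∧ (∀ ξ, lieBracket X1 X3 ξ = 0) ∧
      (∀ ξ, lieBracket X2 X3 ξ = 0) := by
  subst hX1 hX2 hX3
  refine ⟨fun ξ => ?_, fun ξ => ?_, fun ξ => ?_⟩ <;>
  refine lieBracket_eq_zero_of_components (fun i => ?_) (fun i => ?_) (fun i => ?_) <;>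
  fin_cases i <;>
  simp only [Fin.zero_eta, Fin.mk_one, Fin.reduceFinMk, Matrix.cons_val] <;>
  first
  | fun_prop
  | simp (disch := fun_prop) only [fderiv_fun_add, fderiv_fun_sub, fderiv_fun_neg, fderiv_fun_mul,
      fderiv_fun_pow, fderiv_fun_const, fderiv_coordinate, Pi.zero_apply,
      add_apply, sub_apply, neg_apply, smul_apply, zero_apply, ContinuousLinearMap.proj_apply,
      smul_eq_mul, nsmul_eq_mul, Matrix.cons_val]
    ring
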